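/- Let a > −1 and b > −1. For n ≥ 1 set h = 1/(2n+a+b+1) and x_i = h(a+b+i) for i=1,…,2n. Let J be the n×n upper bidiagonal matrix with J_{11} = (1/h)√((a+1)/(a+b+2)), J_{ii} = (1/h)·√((a+i)/(a+b+2i))·√((a+b+i)/(a+b+2i−1)) for i=2,…,n, and J_{i,i+1} = −(1/h)·√((b+i)/(a+b+2i))·√(i/(a+b+1+2i)) for i=1,…,n−1 (this is the ∞-Jacobi matrix model scaled at the hard edge). Define E = J − [ −(1/(2h))∇_n + (a+1/2)·diag(1/x_2, 1/x_4, …, 1/x_{2n})·S_n ]. Then E is upper bidiagonal, and for every ε > 0 there exist C > 0 and n₀ such that for all n ≥ n₀, every entry of E in a row i with i ≥ ε/h has absolute value at most C·h. -/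

import Mathlib

open Matrix Real

noncomputable section

/-- Mesh size `h = 1/(2n+a+b+1)` for the hard edge of the Jacobi model. -/
def jacobiH (a b : ℝ) (n : ℕ) : ℝ := 1 / (2 * n + a + b + 1)

/-- Grid points `x_i = h(a+b+i)`. -/
def jacobiX (a b : ℝ) (n : ℕ) (i : ℕ) : ℝ := jacobiH a b n * (a + b + i)

/-- The ∞-Jacobi matrix model scaled at the hard edge: upper bidiagonal with
`J_{11} = (1/h)√((a+1)/(a+b+2))`,
`J_{ii} = (1/h)√((a+i)/(a+b+2i))·√((a+b+i)/(a+b+2i−1))` for `i ≥ 2`, and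
`J_{i,i+1} = −(1/h)·√((b+i)/(a+b+2i))·√(i/(a+b+1+2i))` (1-based indexing). -/
def jacobiJhard (a b : ℝ) (n : ℕ) : Matrix (Fin n) (Fin n) ℝ :=
  Matrix.of fun i j =>
    if (j : ℕ) = (i : ℕ) then
      (if (i : ℕ) = 0 then (1 / jacobiH a b n) * Real.sqrt ((a + 1) / (a + b + 2))
       else (1 / jacobiH a b n) *
          Real.sqrt ((a + ((i : ℕ) + 1 : ℕ)) / (a + b + 2 * ((i : ℕ) + 1 : ℕ))) *
          Real.sqrt ((a + b + ((i : ℕ) + 1 : ℕ)) / (a + b + 2 * ((i : ℕ) + 1 : ℕ) - 1)))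
    else if (j : ℕ) = (i : ℕ) + 1 then
      -(1 / jacobiH a b n) *
          Real.sqrt ((b + ((i : ℕ) + 1 : ℕ)) / (a + b + 2 * ((i : ℕ) + 1 : ℕ))) *
          Real.sqrt ((((i : ℕ) + 1 : ℕ) : ℝ) / (a + b + 1 + 2 * ((i : ℕ) + 1 : ℕ)))
    else 0

/-- `∇_n`, upper bidiagonal with `−1` on the diagonal and `1` on the superdiagonal. -/
def gradMat (n : ℕ) : Matrix (Fin n) (Fin n) ℝ :=
  Matrix.of fun i j =>
    if (j : ℕ) = (i : ℕ) then -1 else if (j : ℕ) = (i : ℕ) + 1 then 1 else 0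

/-- `S_n`, upper bidiagonal with `1/2` on the diagonal and superdiagonal. -/
def sMat (n : ℕ) : Matrix (Fin n) (Fin n) ℝ :=
  Matrix.of fun i j =>
    if (j : ℕ) = (i : ℕ) ∨ (j : ℕ) = (i : ℕ) + 1 then (1 : ℝ) / 2 else 0

/-- The error term `E = J − [−(1/(2h))∇ + (a+1/2)·diag(1/x₂,…,1/x₂ₙ)·S]`. -/
def jacobiJhardErr (a b : ℝ) (n : ℕ) : Matrix (Fin n) (Fin n) ℝ :=
  jacobiJhard a b n -
    ((-(1 / (2 * jacobiH a b n))) • gradMat n +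
     (a + 1 / 2) • (Matrix.diagonal (fun i : Fin n =>
        1 / jacobiX a b n (2 * (i : ℕ) + 2)) * sMat n))

/-- Second-order expansion at infinity of the square roots occurring in the Jacobi model, with
`σ = 1` on the diagonal and `σ = -1` on the superdiagonal. -/
lemma abs_sqrt_sub_le_div_sq (a b σ m P : ℝ) (hσ : σ ^ 2 = 1) (hm : 4 + |2 * a + 1| ≤ m)
    (hP : 0 ≤ P) (hPeq : P * (4 * m * (m - σ)) = (m + σ * a) ^ 2 - b ^ 2) :
    |√P - (1 / 2 + σ * (2 * a + 1) / (4 * m))| ≤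
      (|4 * a + 3 - 4 * b ^ 2| + (2 * a + 1) ^ 2 + 1) / m ^ 2 := by
  have habs := abs_nonneg (2 * a + 1)
  have hm4 : 4 ≤ m := by linarith
  have hm0 : 0 < m := by linarith
  have hσ1 : |σ| = 1 := by
    rw [← sq_eq_sq₀ (abs_nonneg σ) zero_le_one, sq_abs, hσ, one_pow]
  have hσle : σ ≤ 1 := hσ1 ▸ le_abs_self σ
  have hd : 0 < m - σ := by linarith
  set q : ℝ := 1 / 2 + σ * (2 * a + 1) / (4 * m) with hq
  have hq4 : 1 / 4 ≤ q := by
    have h1 : |σ * (2 * a + 1) / (4 * m)| ≤ 1 / 4 := by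
      rw [abs_div, abs_mul, hσ1, one_mul, abs_of_pos (by positivity : 0 < 4 * m),
        div_le_div_iff₀ (by positivity) (by norm_num)]
      linarith
    linarith [(abs_le.mp h1).1]
  have hP' : P = ((m + σ * a) ^ 2 - b ^ 2) / (4 * m * (m - σ)) := by
    rw [eq_div_iff (by positivity), hPeq]
  have hdiff : P - q ^ 2 =
      ((4 * a + 3 - 4 * b ^ 2) * m + σ * (2 * a + 1) ^ 2) / (16 * m ^ 2 * (m - σ)) := by
    rw [hP', hq]
    have := hd.ne'
    field_simp
    linear_combination 64 * (m * (4 * a + 3) + σ * (2 * a + 1) ^ 2) * hσ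
  set L : ℝ := |4 * a + 3 - 4 * b ^ 2| + (2 * a + 1) ^ 2 with hL
  have hL0 : 0 ≤ L := by positivity
  have hnum : |(4 * a + 3 - 4 * b ^ 2) * m + σ * (2 * a + 1) ^ 2| ≤ L * m := by
    calc _ ≤ |(4 * a + 3 - 4 * b ^ 2) * m| + |σ * (2 * a + 1) ^ 2| := abs_add_le _ _
      _ = |4 * a + 3 - 4 * b ^ 2| * m + (2 * a + 1) ^ 2 := by
        rw [abs_mul, abs_mul, hσ1, abs_of_pos hm0, abs_of_nonneg (sq_nonneg (2 * a + 1)), one_mul]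
      _ ≤ L * m := by rw [hL]; nlinarith [sq_nonneg (2 * a + 1)]
  have hbound : |P - q ^ 2| ≤ L / (8 * m ^ 2) := by
    rw [hdiff, abs_div, abs_of_pos (by positivity : 0 < 16 * m ^ 2 * (m - σ)),
      div_le_div_iff₀ (by positivity) (by positivity)]
    calc _ ≤ L * m * (8 * m ^ 2) := by gcongr
      _ ≤ L * (2 * (m - σ)) * (8 * m ^ 2) := by gcongr; linarith
      _ = _ := by ring
  have hfac : |√P - q| * (√P + q) = |P - q ^ 2| := by
    rw [← abs_of_nonneg (add_nonneg (Real.sqrt_nonneg P) (by linarith : 0 ≤ q)), ← abs_mul]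
    congr 1
    linear_combination Real.sq_sqrt hP
  have h1 : |√P - q| * (1 / 4) ≤ L / (8 * m ^ 2) := by
    refine le_trans ?_ (hfac.trans_le hbound)
    gcongr
    linarith [Real.sqrt_nonneg P]
  calc |√P - q| ≤ 4 * (L / (8 * m ^ 2)) := by linarith
    _ = L / 2 / m ^ 2 := by ring
    _ ≤ (L + 1) / m ^ 2 := by gcongr; linarith

lemma jacobiJhardErr_apply (a b : ℝ) (n : ℕ) (i j : Fin n) :
    jacobiJhardErr a b n i j = jacobiJhard a b n i j -
      (-(1 / (2 * jacobiH a b n)) * gradMat n i j +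
        (a + 1 / 2) * (1 / jacobiX a b n (2 * (i : ℕ) + 2) * sMat n i j)) := by
  simp [jacobiJhardErr, Matrix.diagonal_mul]

lemma jacobiJhardErr_eq_zero (a b : ℝ) (n : ℕ) (i j : Fin n) (h0 : (j : ℕ) ≠ i)
    (h1 : (j : ℕ) ≠ (i : ℕ) + 1) : jacobiJhardErr a b n i j = 0 := by
  simp [jacobiJhardErr_apply, jacobiJhard, gradMat, sMat, h0, h1]

lemma jacobiJhardErr_diag (a b : ℝ) (n : ℕ) (i j : Fin n) (k : ℝ) (hk : k = (i : ℕ) + 1)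
    (hi : (i : ℕ) ≠ 0) (hj : (j : ℕ) = i)
    (hnn : 0 ≤ (a + k) / (a + b + 2 * k)) :
    jacobiJhardErr a b n i j = 1 / jacobiH a b n *
      (√((a + k) / (a + b + 2 * k) * ((a + b + k) / (a + b + 2 * k - 1))) -
        (1 / 2 + 1 * (2 * a + 1) / (4 * (a + b + 2 * k)))) := by
  have hcast : (((i : ℕ) + 1 : ℕ) : ℝ) = k := by rw [hk]; push_cast; ring
  have hX : jacobiX a b n (2 * (i : ℕ) + 2) = jacobiH a b n * (a + b + 2 * k) := by
    rw [jacobiX, hk]; push_cast; ring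
  rw [jacobiJhardErr_apply, hX, Real.sqrt_mul hnn]
  simp only [jacobiJhard, gradMat, sMat, Matrix.of_apply, hj, hi, hcast, if_true, if_false, true_or]
  simp only [mul_inv, div_eq_mul_inv]
  ring

lemma jacobiJhardErr_superdiag (a b : ℝ) (n : ℕ) (i j : Fin n) (k : ℝ) (hk : k = (i : ℕ) + 1)
    (hj : (j : ℕ) = (i : ℕ) + 1) (hnn : 0 ≤ (b + k) / (a + b + 2 * k)) :
    jacobiJhardErr a b n i j = -(1 / jacobiH a b n *
      (√((b + k) / (a + b + 2 * k) * (k / (a + b + 1 + 2 * k))) -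
        (1 / 2 + (-1) * (2 * a + 1) / (4 * (a + b + 2 * k))))) := by
  have hcast : (((i : ℕ) + 1 : ℕ) : ℝ) = k := by rw [hk]; push_cast; ring
  have hX : jacobiX a b n (2 * (i : ℕ) + 2) = jacobiH a b n * (a + b + 2 * k) := by
    rw [jacobiX, hk]; push_cast; ring
  have hne : (i : ℕ) + 1 ≠ i := by omega
  rw [jacobiJhardErr_apply, hX, Real.sqrt_mul hnn]
  simp only [jacobiJhard, gradMat, sMat, Matrix.of_apply, hj, hne, hcast, if_true, if_false, or_true]
  simp only [mul_inv, div_eq_mul_inv]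
  ring

/-- Rows far enough from the edge have entries of size `O(1 / (h k²))`, where `k` is the 1-based
row index. -/
lemma abs_jacobiJhardErr_le (a b : ℝ) (ha : -1 < a) (hb : -1 < b) (n : ℕ) (i j : Fin n) (k : ℝ)
    (hk : k = (i : ℕ) + 1) (hkM : 4 + |2 * a + 1| ≤ k) (hh : 0 < jacobiH a b n) :
    |jacobiJhardErr a b n i j| ≤ 1 / jacobiH a b n *
      ((|4 * a + 3 - 4 * b ^ 2| + (2 * a + 1) ^ 2 + 1) / k ^ 2) := by
  have hk4 : 4 ≤ k := by linarith [abs_nonneg (2 * a + 1)]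
  have hmk : k ≤ a + b + 2 * k := by linarith
  have hm0 : 0 < a + b + 2 * k := by linarith
  have hk0 : 0 < k := by linarith
  have hak : 0 < a + k := by linarith
  have hbk : 0 < b + k := by linarith
  have habk : 0 < a + b + k := by linarith
  have hm1 : 0 < a + b + 2 * k - 1 := by linarith
  have hm2 : 0 < a + b + 1 + 2 * k := by linarith
  have hmono : (|4 * a + 3 - 4 * b ^ 2| + (2 * a + 1) ^ 2 + 1) / (a + b + 2 * k) ^ 2 ≤
      (|4 * a + 3 - 4 * b ^ 2| + (2 * a + 1) ^ 2 + 1) / k ^ 2 := by gcongr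
  have hinv : 0 < 1 / jacobiH a b n := by positivity
  by_cases h0 : (j : ℕ) = i
  · have hi : (i : ℕ) ≠ 0 := by
      intro h
      rw [h] at hk
      norm_num at hk
      linarith
    rw [jacobiJhardErr_diag a b n i j k hk hi h0 (by positivity), abs_mul, abs_of_pos hinv]
    refine mul_le_mul_of_nonneg_left (le_trans ?_ hmono) hinv.le
    refine abs_sqrt_sub_le_div_sq a b 1 _ _ (by norm_num) (by linarith) (by positivity) ?_
    rw [div_mul_div_comm, div_mul_eq_mul_div, div_eq_iff (by positivity)]
    ring
  by_cases h1 : (j : ℕ) = (i : ℕ) + 1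
  · rw [jacobiJhardErr_superdiag a b n i j k hk h1 (by positivity), abs_neg, abs_mul,
      abs_of_pos hinv]
    refine mul_le_mul_of_nonneg_left (le_trans ?_ hmono) hinv.le
    refine abs_sqrt_sub_le_div_sq a b (-1) _ _ (by norm_num) (by linarith) (by positivity) ?_
    rw [div_mul_div_comm, div_mul_eq_mul_div, div_eq_iff (by positivity)]
    ring
  · rw [jacobiJhardErr_eq_zero a b n i j h0 h1, abs_zero]
    positivity

/-- the hard-edge–scaled ∞-Jacobi matrix model is a finite
difference scheme for the Bessel operator in Liouville normal form
`−d/dx + (a+1/2)/x`: the error term `E` is upper bidiagonal, and for each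
`ε > 0` its entries in rows `i ≥ ε/h` are uniformly `O(h)`. -/
theorem jacobiJhard_finite_difference (a b : ℝ) (ha : -1 < a) (hb : -1 < b) :
    (∀ n : ℕ, 1 ≤ n → ∀ i j : Fin n,
      (j : ℕ) ≠ (i : ℕ) → (j : ℕ) ≠ (i : ℕ) + 1 → jacobiJhardErr a b n i j = 0) ∧
    (∀ ε : ℝ, 0 < ε → ∃ C > (0 : ℝ), ∃ n₀ : ℕ, ∀ n : ℕ, n₀ ≤ n → ∀ i j : Fin n,
      ε / jacobiH a b n ≤ ((i : ℕ) + 1 : ℝ) →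
        |jacobiJhardErr a b n i j| ≤ C * jacobiH a b n) := by
  refine ⟨fun n _ i j h0 h1 => jacobiJhardErr_eq_zero a b n i j h0 h1, fun ε hε => ?_⟩
  set K : ℝ := |4 * a + 3 - 4 * b ^ 2| + (2 * a + 1) ^ 2 + 1
  have hK0 : 0 < K := by positivity
  obtain ⟨N, hN⟩ := exists_nat_ge ((4 + |2 * a + 1|) / ε)
  refine ⟨K / ε ^ 2, by positivity, max N 1, fun n hn i j hij => ?_⟩
  have hnN : (N : ℝ) ≤ n := by exact_mod_cast (le_max_left _ _).trans hn
  have hn1 : (1 : ℝ) ≤ n := by exact_mod_cast (le_max_right _ _).trans hn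
  have hden : (n : ℝ) ≤ 2 * n + a + b + 1 := by linarith
  have hh : 0 < jacobiH a b n := by
    rw [jacobiH]
    exact one_div_pos.mpr (by linarith)
  have hεh : ε / jacobiH a b n = ε * (2 * n + a + b + 1) := by
    rw [jacobiH, div_div_eq_mul_div, div_one]
  have hkM : 4 + |2 * a + 1| ≤ (i : ℕ) + 1 := by
    refine le_trans ?_ hij
    rw [hεh, ← div_le_iff₀' hε]
    linarith
  calc |jacobiJhardErr a b n i j|
      ≤ 1 / jacobiH a b n * (K / ((i : ℕ) + 1 : ℝ) ^ 2) :=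
        abs_jacobiJhardErr_le a b ha hb n i j _ rfl hkM hh
    _ ≤ 1 / jacobiH a b n * (K / (ε / jacobiH a b n) ^ 2) := by gcongr
    _ = K / ε ^ 2 * jacobiH a b n := by field_simp

end
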